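/- arXiv:2103.16984 — 6 statements merged into one kernel-verified Lean document; each statement's English description precedes it below -/
import Mathlib

section
/- Let R be a commutative ring, n ≥ 1 a natural number, and let w : Fin n → Fin n → R be a symmetric weight function (w i j = w j i for all i, j). Define the weighted Laplacian matrix L ∈ Matrix (Fin n) (Fin n) R by L i j = w i j for i ≠ j and L i i = −∑_{k ≠ i} w i k. Then for every vertex v : Fin n, the determinant of the (n−1)×(n−1) matrix obtained from L by deleting row v and column v equals (−1)^{n−1} times the sum, over all spanning trees T of the complete graph on the vertex set Fin n, of the products ∏_{{i,j} ∈ T} w i j. -/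
open scoped Classical

/-- The graph joining every vertex `a` to its image `g a`. -/
def parentGraph {V : Type*} (g : V → V) : SimpleGraph V :=
  SimpleGraph.fromRel fun a b => g a = b

/-- Every vertex is mapped to the root `r` by some iterate of `g`. -/
def IterReaches {V : Type*} (g : V → V) (r : V) : Prop :=
  ∀ a, ∃ k, g^[k] a = r

section ParentGraph

variable {V : Type*} {g : V → V} {r : V}

lemma parentGraph_adj {a b : V} :
    (parentGraph g).Adj a b ↔ a ≠ b ∧ (g a = b ∨ g b = a) :=
  SimpleGraph.fromRel_adj _ _ _

lemma IterReaches.apply_ne (h : IterReaches g r) {a : V} (ha : a ≠ r) : g a ≠ a := by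
  intro hfix
  obtain ⟨k, hk⟩ := h a
  rw [Function.iterate_fixed hfix] at hk
  exact ha hk

lemma IterReaches.apply_apply_ne (h : IterReaches g r) {a : V} (ha : a ≠ r) (hga : g a ≠ r) :
    g (g a) ≠ a := by
  intro hcycle
  obtain ⟨k, hk⟩ := h a
  have key : ∀ m, g^[m] a = a ∨ g^[m] a = g a := by
    intro m
    induction m with
    | zero => exact Or.inl rfl
    | succ m ih =>
      rw [Function.iterate_succ_apply']
      rcases ih with h' | h' <;> rw [h']
      · exact Or.inr rfl
      · exact Or.inl hcycle
  rcases key k with h' | h'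
  · exact ha (h'.symm.trans hk)
  · exact hga (h'.symm.trans hk)

lemma IterReaches.connected_parentGraph (h : IterReaches g r) : (parentGraph g).Connected := by
  have step : ∀ a, (parentGraph g).Reachable a (g a) := by
    intro a
    by_cases ha : a = g a
    · rw [← ha]
    · exact (parentGraph_adj.2 ⟨ha, Or.inl rfl⟩).reachable
  have iter : ∀ k a, (parentGraph g).Reachable a (g^[k] a) := by
    intro k
    induction k with
    | zero => exact fun a => SimpleGraph.Reachable.refl a
    | succ k ih => exact fun a => (step a).trans (ih (g a))
  have root : ∀ a, (parentGraph g).Reachable a r := by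
    intro a
    obtain ⟨k, hk⟩ := h a
    exact hk ▸ iter k a
  have : Nonempty V := ⟨r⟩
  exact SimpleGraph.Connected.mk fun a b => (root a).trans (root b).symm

lemma IterReaches.edgeSet_parentGraph (h : IterReaches g r) (hr : g r = r) :
    (parentGraph g).edgeSet = (fun a => s(a, g a)) '' {r}ᶜ := by
  ext e
  induction e with
  | h a b =>
    simp only [SimpleGraph.mem_edgeSet, parentGraph_adj, Set.mem_image, Set.mem_compl_iff,
      Set.mem_singleton_iff]
    constructor
    · rintro ⟨hab, rfl | rfl⟩
      · exact ⟨a, fun ha => hab (by rw [ha, hr]), rfl⟩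
      · exact ⟨b, fun hb => hab (by rw [hb, hr]), Sym2.eq_swap⟩
    · rintro ⟨c, hc, hce⟩
      have hne := h.apply_ne hc
      rcases Sym2.eq_iff.1 hce with ⟨rfl, rfl⟩ | ⟨rfl, rfl⟩
      · exact ⟨hne.symm, Or.inl rfl⟩
      · exact ⟨hne, Or.inr rfl⟩

lemma IterReaches.eq_of_parentGraph_eq {g' : V → V} (h : IterReaches g r) (hr : g r = r)
    (hr' : g' r = r) (hgg : parentGraph g = parentGraph g') : g = g' := by
  have key : ∀ k a, g^[k] a = r → g a = g' a := by
    intro k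
    induction k with
    | zero =>
      rintro a rfl
      exact hr.trans hr'.symm
    | succ k ih =>
      intro a hk
      have hga := ih (g a) hk
      by_cases ha : a = r
      · rw [ha, hr, hr']
      have hadj : (parentGraph g').Adj a (g a) :=
        hgg ▸ parentGraph_adj.2 ⟨(h.apply_ne ha).symm, Or.inl rfl⟩
      rcases (parentGraph_adj.1 hadj).2 with h1 | h1
      · exact h1.symm
      · have hgr : g a ≠ r := by
          intro hgr
          rw [hgr, hr'] at h1
          exact ha h1.symm
        exact absurd (hga.trans h1) (h.apply_apply_ne ha hgr)
  funext a
  obtain ⟨k, hk⟩ := h a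
  exact key k a hk

lemma IterReaches.card_edgeSet_parentGraph_le [Fintype V] (h : IterReaches g r) (hr : g r = r) :
    Nat.card (parentGraph g).edgeSet + 1 ≤ Nat.card V := by
  classical
  rw [h.edgeSet_parentGraph hr]
  have h1 := Nat.card_image_le (f := fun a => s(a, g a)) (Set.toFinite ({r}ᶜ : Set V))
  have h2 : Nat.card ({r}ᶜ : Set V) + 1 = Nat.card V := by
    have := Set.ncard_add_ncard_compl ({r} : Set V)
    rw [Set.ncard_singleton] at this
    rw [Nat.card_coe_set_eq]
    omega
  omega

lemma IterReaches.isTree_parentGraph [Fintype V] (h : IterReaches g r) (hr : g r = r) :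
    (parentGraph g).IsTree := by
  refine SimpleGraph.isTree_iff_connected_and_card.2 ⟨h.connected_parentGraph, ?_⟩
  exact le_antisymm (h.card_edgeSet_parentGraph_le hr)
    h.connected_parentGraph.card_vert_le_card_edgeSet_add_one

lemma IterReaches.injOn_edge [Fintype V] (h : IterReaches g r) (hr : g r = r) :
    Set.InjOn (fun a => s(a, g a)) {r}ᶜ := by
  rw [← Set.ncard_image_iff, ← h.edgeSet_parentGraph hr]
  have h1 := (SimpleGraph.isTree_iff_connected_and_card.1 (h.isTree_parentGraph hr)).2
  have h2 := Set.ncard_add_ncard_compl ({r} : Set V)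
  rw [Set.ncard_singleton] at h2
  rw [Nat.card_coe_set_eq] at h1
  omega

lemma IterReaches.prod_edgeFinset [Fintype V] [DecidableEq V] {R : Type*} [CommRing R]
    (h : IterReaches g r) (hr : g r = r) [Fintype (parentGraph g).edgeSet] (φ : Sym2 V → R) :
    ∏ e ∈ (parentGraph g).edgeFinset, φ e = ∏ a ∈ {r}ᶜ, φ s(a, g a) := by
  have himage : (parentGraph g).edgeFinset = Finset.image (fun a => s(a, g a)) {r}ᶜ := by
    apply Finset.coe_injective
    rw [SimpleGraph.coe_edgeFinset, h.edgeSet_parentGraph hr]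
    simp
  rw [himage, Finset.prod_image]
  simpa using h.injOn_edge hr

end ParentGraph

lemma SimpleGraph.Connected.exists_adj_dist_lt {V : Type*} {G : SimpleGraph V}
    (hG : G.Connected) {a r : V} (ha : a ≠ r) : ∃ b, G.Adj a b ∧ G.dist b r < G.dist a r := by
  obtain ⟨p, hp⟩ := hG.exists_walk_length_eq_dist a r
  cases p with
  | nil => exact absurd rfl ha
  | cons hadj q =>
    refine ⟨_, hadj, ?_⟩
    rw [← hp, SimpleGraph.Walk.length_cons]
    exact Nat.lt_succ_of_le (SimpleGraph.dist_le q)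

lemma SimpleGraph.IsTree.exists_parentGraph_eq {V : Type*} {G : SimpleGraph V}
    (hG : G.IsTree) (r : V) :
    ∃ g : V → V, g r = r ∧ IterReaches g r ∧ parentGraph g = G := by
  classical
  choose! p hp using fun a (ha : a ≠ r) => hG.connected.exists_adj_dist_lt ha
  let g : V → V := fun a => if a = r then r else p a
  have hgr : g r = r := if_pos rfl
  have hg : ∀ a, a ≠ r → g a = p a := fun a ha => if_neg ha
  have hreach : IterReaches g r := by
    intro a
    induction hd : G.dist a r using Nat.strong_induction_on generalizing a with
    | _ d ih =>
      by_cases ha : a = r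
      · exact ⟨0, ha⟩
      · obtain ⟨k, hk⟩ := ih _ (hd ▸ (hp a ha).2) (p a) rfl
        exact ⟨k + 1, by rw [Function.iterate_succ_apply, hg a ha, hk]⟩
  have hadj : ∀ a, a ≠ g a → G.Adj a (g a) := by
    intro a hne
    have ha : a ≠ r := fun ha => hne (by rw [ha, hgr])
    rw [hg a ha]
    exact (hp a ha).1
  have hle : parentGraph g ≤ G := by
    intro a b hab
    obtain ⟨hne, rfl | rfl⟩ := parentGraph_adj.1 hab
    · exact hadj a hne
    · exact (hadj b hne.symm).symm
  exact ⟨g, hgr, hreach, le_antisymm hle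
    ((SimpleGraph.isTree_iff_minimal_connected.1 hG).2 hreach.connected_parentGraph hle)⟩

/-- The reduced incidence-type matrix, with rows `e_i - e_{f i}` and `e_v = 0`. -/
def parentMatrix (R : Type*) [CommRing R] {n : ℕ} (v : Fin (n + 1)) (f : Fin n → Fin (n + 1)) :
    Matrix (Fin n) (Fin n) R :=
  Matrix.of fun i j => (if i = j then 1 else 0) - if f i = v.succAbove j then 1 else 0

section ParentMatrix

variable (R : Type*) [CommRing R] {n : ℕ} {v : Fin (n + 1)} {f : Fin n → Fin (n + 1)}

lemma det_parentMatrix_of_iterReaches (h : IterReaches (v.insertNth v f : Fin (n + 1) → _) v) :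
    (parentMatrix R v f).det = 1 := by
  classical
  set g : Fin (n + 1) → Fin (n + 1) := v.insertNth v f
  have hgf : ∀ i, g (v.succAbove i) = f i := fun i => Fin.insertNth_apply_succAbove ..
  let depth : Fin n → ℕ := fun i => Nat.find (h (v.succAbove i))
  have hdepth : ∀ i j, f i = v.succAbove j → depth j < depth i := by
    intro i j hij
    have hi : g^[depth i] (v.succAbove i) = v := Nat.find_spec (h (v.succAbove i))
    rcases hm : depth i with _ | m
    · rw [hm] at hi
      exact absurd hi (Fin.succAbove_ne v i)
    · rw [hm, Function.iterate_succ_apply, hgf, hij] at hi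
      exact Nat.lt_succ_of_le (Nat.find_min' (h (v.succAbove j)) hi)
  have htri : (parentMatrix R v f).BlockTriangular (fun i => OrderDual.toDual (depth i)) := by
    intro i j hij
    have hij' : depth i < depth j := hij
    have h1 : i ≠ j := by rintro rfl; exact lt_irrefl _ hij'
    have h2 : f i ≠ v.succAbove j := fun h2 => lt_asymm hij' (hdepth i j h2)
    simp [parentMatrix, h1, h2]
  rw [htri.det]
  refine Finset.prod_eq_one fun d _ => ?_
  have hone : (parentMatrix R v f).toSquareBlock (fun i => OrderDual.toDual (depth i)) d = 1 := by
    ext ⟨i, hi⟩ ⟨j, hj⟩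
    have hij : depth i = depth j := OrderDual.toDual.injective (hi.trans hj.symm)
    have h2 : f i ≠ v.succAbove j := fun h2 => (hdepth i j h2).ne' hij
    simp [parentMatrix, Matrix.toSquareBlock_def, h2, Matrix.one_apply]
  rw [hone, Matrix.det_one]

lemma det_parentMatrix_of_not_iterReaches
    (h : ¬ IterReaches (v.insertNth v f : Fin (n + 1) → _) v) :
    (parentMatrix R v f).det = 0 := by
  classical
  set g : Fin (n + 1) → Fin (n + 1) := v.insertNth v f
  have hgf : ∀ i, g (v.succAbove i) = f i := fun i => Fin.insertNth_apply_succAbove ..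
  have hgv : g v = v := Fin.insertNth_apply_same ..
  let x : Fin (n + 1) → R := fun a => if ∃ k, g^[k] a = v then 0 else 1
  have hxg : ∀ a, x (g a) = x a := by
    intro a
    have : (∃ k, g^[k] (g a) = v) ↔ ∃ k, g^[k] a = v := by
      constructor
      · rintro ⟨k, hk⟩
        exact ⟨k + 1, hk⟩
      · rintro ⟨k, hk⟩
        refine ⟨k, ?_⟩
        rw [← Function.iterate_succ_apply, Function.iterate_succ_apply', hk, hgv]
    simp only [x, this]
  have hxv : x v = 0 := if_pos ⟨0, rfl⟩
  have hsum : ∀ b, ∑ j, (if b = v.succAbove j then x (v.succAbove j) else 0) = x b := by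
    intro b
    have := Fin.sum_univ_succAbove (fun c => if b = c then x c else 0) v
    simp only [hxv, ite_self, zero_add] at this
    rw [← this]
    simp
  have hker : (parentMatrix R v f).mulVec (fun j => x (v.succAbove j)) = 0 := by
    funext i
    simp only [parentMatrix, Matrix.mulVec, dotProduct, Matrix.of_apply, sub_mul, ite_mul, one_mul,
      zero_mul, Finset.sum_sub_distrib, hsum, Finset.sum_ite_eq, Finset.mem_univ, if_true,
      Pi.zero_apply]
    rw [← hgf, hxg, sub_self]
  obtain ⟨a, ha⟩ := not_forall.1 h
  have hav : a ≠ v := fun hav => ha ⟨0, hav⟩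
  obtain ⟨i, rfl⟩ := Fin.exists_succAbove_eq hav
  have hzero := congrFun (congrArg (parentMatrix R v f).adjugate.mulVec hker) i
  rw [Matrix.mulVec_mulVec, Matrix.adjugate_mul, Matrix.smul_mulVec, Matrix.one_mulVec,
    Matrix.mulVec_zero] at hzero
  simpa [x, ha] using hzero

end ParentMatrix

lemma det_weighted_sum_parentMatrix {R : Type*} [CommRing R] {n : ℕ} (v : Fin (n + 1))
    (c : Fin n → Fin (n + 1) → R) :
    (Matrix.of fun i j => ∑ k, c i k *
        ((if i = j then 1 else 0) - if k = v.succAbove j then 1 else 0) :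
      Matrix (Fin n) (Fin n) R).det =
      ∑ f : Fin n → Fin (n + 1), (∏ i, c i (f i)) * (parentMatrix R v f).det := by
  have hrow := (Matrix.detRowAlternating (n := Fin n) (R := R)).toMultilinearMap.map_sum
    (fun i (k : Fin (n + 1)) => c i k • fun j : Fin n =>
      ((if i = j then 1 else 0) - if k = v.succAbove j then 1 else 0 : R))
  convert hrow using 1
  · change Matrix.det _ = Matrix.det _
    congr 1
    ext i j
    simp [Finset.sum_apply]
  · refine Finset.sum_congr rfl fun f _ => ?_
    rw [MultilinearMap.map_smul_univ]
    rfl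

lemma laplacian_submatrix_eq_neg {R : Type*} [CommRing R] {n : ℕ}
    (w : Fin (n + 1) → Fin (n + 1) → R) (L : Matrix (Fin (n + 1)) (Fin (n + 1)) R)
    (hoff : ∀ i j, i ≠ j → L i j = w i j)
    (hdiag : ∀ i, L i i = -∑ k ∈ Finset.univ.erase i, w i k) (v : Fin (n + 1)) :
    L.submatrix v.succAbove v.succAbove = -Matrix.of fun i j => ∑ k, w (v.succAbove i) k *
        ((if i = j then 1 else 0) - if k = v.succAbove j then 1 else 0) := by
  ext i j
  simp only [Matrix.submatrix_apply, Matrix.neg_apply, Matrix.of_apply, mul_sub,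
    Finset.sum_sub_distrib, mul_ite, mul_one, mul_zero, Finset.sum_ite_eq', Finset.mem_univ,
    if_true]
  by_cases hij : i = j
  · subst hij
    simp only [hdiag, if_true]
    rw [← Finset.add_sum_erase _ _ (Finset.mem_univ (v.succAbove i)), add_sub_cancel_left]
  · rw [hoff _ _ (fun h => hij (Fin.succAbove_right_injective h))]
    simp [hij]

/-- **Weighted matrix-tree theorem.** For a symmetric weight function `w` on `Fin (n+1)`
and the weighted Laplacian `L` (off-diagonal entries `w i j`, diagonal entries
`-∑_{k ≠ i} w i k`), the principal minor of `L` obtained by deleting row and column `v`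
equals `(-1)^n` times the sum, over all spanning trees of the complete graph on
`Fin (n+1)`, of the products of the weights of the edges of the tree. -/
theorem weighted_matrix_tree_theorem {R : Type*} [CommRing R] (n : ℕ)
    (w : Fin (n + 1) → Fin (n + 1) → R) (hw : ∀ i j, w i j = w j i)
    (L : Matrix (Fin (n + 1)) (Fin (n + 1)) R)
    (hoff : ∀ i j, i ≠ j → L i j = w i j)
    (hdiag : ∀ i, L i i = -∑ k ∈ Finset.univ.erase i, w i k)
    (v : Fin (n + 1)) :
    (L.submatrix v.succAbove v.succAbove).det =
      (-1) ^ n *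
        ∑ G ∈ Finset.univ.filter (fun G : SimpleGraph (Fin (n + 1)) => G.IsTree),
          ∏ e ∈ G.edgeFinset, Sym2.lift ⟨w, hw⟩ e := by
  classical
  rw [laplacian_submatrix_eq_neg w L hoff hdiag v, Matrix.det_neg, Fintype.card_fin,
    det_weighted_sum_parentMatrix]
  congr 1
  have hroot : ∀ f : Fin n → Fin (n + 1), (v.insertNth v f : Fin (n + 1) → Fin (n + 1)) v = v :=
    fun f => Fin.insertNth_apply_same ..
  rw [← Finset.sum_filter_add_sum_filter_not Finset.univ
    (fun f : Fin n → Fin (n + 1) => IterReaches (v.insertNth v f : Fin (n + 1) → _) v),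
    add_eq_left.2 (Finset.sum_eq_zero fun f hf => by
      rw [det_parentMatrix_of_not_iterReaches R (Finset.mem_filter.1 hf).2, mul_zero])]
  refine Finset.sum_bij
    (fun f _ => parentGraph (v.insertNth v f : Fin (n + 1) → Fin (n + 1))) ?_ ?_ ?_ ?_
  · intro f hf
    exact Finset.mem_filter.2
      ⟨Finset.mem_univ _, (Finset.mem_filter.1 hf).2.isTree_parentGraph (hroot f)⟩
  · intro f hf f' _ hff
    have hgg := (Finset.mem_filter.1 hf).2.eq_of_parentGraph_eq (hroot f) (hroot f') hff
    funext i
    simpa using congrFun hgg (v.succAbove i)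
  · intro G hG
    obtain ⟨g, hgv, hreach, rfl⟩ := (Finset.mem_filter.1 hG).2.exists_parentGraph_eq v
    have hg : (v.insertNth v (fun i => g (v.succAbove i)) : Fin (n + 1) → Fin (n + 1)) = g :=
      Fin.insertNth_eq_iff.2 ⟨hgv.symm, rfl⟩
    exact ⟨fun i => g (v.succAbove i),
      Finset.mem_filter.2 ⟨Finset.mem_univ _, hg.symm ▸ hreach⟩, by rw [hg]⟩
  · intro f hf
    have hreach := (Finset.mem_filter.1 hf).2
    rw [det_parentMatrix_of_iterReaches R hreach, mul_one, hreach.prod_edgeFinset (hroot f),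
      ← Fin.image_succAbove_univ, Finset.prod_image Fin.succAbove_right_injective.injOn]
    simp
end

section
/- Let K be a field, M an n×n symmetric matrix over K, r ≤ n, and N an n×r matrix over K with M·N = 0 (every column of N lies in the kernel of M). For a subset S ⊆ {1,…,n} with |S| = r, let M_(S) denote the (n−r)×(n−r) matrix obtained from M by deleting the rows and columns indexed by S, and let N_[S] denote the r×r matrix formed by the rows of N indexed by S. Then for any two subsets S and T of size r: det(M_(S)) · (det N_[T])² = det(M_(T)) · (det N_[S])². -/
open Matrix

/-- The `(n-r) × (n-r)` submatrix of `M` obtained by deleting the rows and columns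
indexed by the `r`-element subset `S` of `Fin n`. -/
def deleteRowsCols {K : Type*} [Field K] {n r : ℕ}
    (M : Matrix (Fin n) (Fin n) K) (S : Finset (Fin n)) (h : Sᶜ.card = n - r) :
    Matrix (Fin (n - r)) (Fin (n - r)) K :=
  M.submatrix (fun i => (Sᶜ.orderIsoOfFin h i : Fin n))
    (fun i => (Sᶜ.orderIsoOfFin h i : Fin n))

/-- The `r × r` matrix formed by the rows of the `n × r` matrix `N` indexed by the
`r`-element subset `S` of `Fin n`. -/
def selectRows {K : Type*} [Field K] {n r : ℕ}
    (N : Matrix (Fin n) (Fin r) K) (S : Finset (Fin n)) (h : S.card = r) :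
    Matrix (Fin r) (Fin r) K :=
  N.submatrix (fun i => (S.orderIsoOfFin h i : Fin n)) id

theorem compl_card_of_card {n r : ℕ} (S : Finset (Fin n)) (hS : S.card = r) :
    Sᶜ.card = n - r := by
  rw [Finset.card_compl, hS, Fintype.card_fin]

/-- If `A * N = 0`, the maximal minors of `A` are proportional to the complementary maximal minors
of `N`; the sign depends only on the two splittings `e`, `f` of the index set. -/
theorem det_submatrix_mul_det_submatrix_of_mul_eq_zero {R ι m p : Type*} [CommRing R]
    [Fintype ι] [DecidableEq ι] [Fintype m] [DecidableEq m] [Fintype p] [DecidableEq p]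
    (A : Matrix m ι R) (N : Matrix ι p R) (h : A * N = 0) (e f : p ⊕ m ≃ ι) :
    (A.submatrix id (e ∘ Sum.inr)).det * (N.submatrix (f ∘ Sum.inl) id).det =
      (Equiv.Perm.sign (f.trans e.symm) : R) *
        ((A.submatrix id (f ∘ Sum.inr)).det * (N.submatrix (e ∘ Sum.inl) id).det) := by
  set X : Matrix (p ⊕ m) ι R :=
    fromRows ((1 : Matrix ι ι R).submatrix (f ∘ Sum.inl) id) A with hX
  set Y : Matrix ι (p ⊕ m) R :=
    fromCols N ((1 : Matrix ι ι R).submatrix id (e ∘ Sum.inr)) with hY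
  have hXf : X.submatrix id f =
      fromBlocks 1 0 (A.submatrix id (f ∘ Sum.inl)) (A.submatrix id (f ∘ Sum.inr)) := by
    ext (i | i) (j | j) <;> simp [hX, one_apply]
  have hYe : Y.submatrix e id =
      fromBlocks (N.submatrix (e ∘ Sum.inl) id) 0 (N.submatrix (e ∘ Sum.inr) id) 1 := by
    ext (i | i) (j | j) <;> simp [hY, one_apply]
  have hYf : (Y.submatrix f id).det =
      (Equiv.Perm.sign (f.trans e.symm) : R) * (Y.submatrix e id).det := by
    rw [← det_permute]
    congr 1
    ext i j
    simp
  have hXY : X * Y = fromBlocks (N.submatrix (f ∘ Sum.inl) id)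
      ((1 : Matrix ι ι R).submatrix (f ∘ Sum.inl) (e ∘ Sum.inr)) 0
      (A.submatrix id (e ∘ Sum.inr)) := by
    rw [hX, hY, fromRows_mul_fromCols, h]
    congr 1 <;> ext i j <;> simp [mul_apply, one_apply]
  have key : (X * Y).det = (X.submatrix id f).det * (Y.submatrix f id).det := by
    rw [← det_mul, submatrix_mul_equiv, submatrix_id_id]
  rw [hXY, hYf, hXf, hYe, det_fromBlocks_zero₂₁, det_fromBlocks_zero₁₂,
    det_fromBlocks_zero₁₂, det_one, det_one] at key
  linear_combination key

/-- For a symmetric matrix `M` over a field whose kernel contains all columns of `N`,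
the complementary minors satisfy
`det M_(S) · (det N_[T])² = det M_(T) · (det N_[S])²` for any two `r`-element
subsets `S, T`. -/
theorem complementary_minors_symm_kernel {K : Type*} [Field K] (n r : ℕ) (hrn : r ≤ n)
    (M : Matrix (Fin n) (Fin n) K) (hsymm : Mᵀ = M)
    (N : Matrix (Fin n) (Fin r) K) (hker : M * N = 0)
    (S T : Finset (Fin n)) (hS : S.card = r) (hT : T.card = r) :
    (deleteRowsCols M S (compl_card_of_card S hS)).det * (selectRows N T hT).det ^ 2 =
      (deleteRowsCols M T (compl_card_of_card T hT)).det * (selectRows N S hS).det ^ 2 := by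
  have hS' := compl_card_of_card S hS
  have hT' := compl_card_of_card T hT
  let e := finSumEquivOfFinset hS hS'
  let f := finSumEquivOfFinset hT hT'
  have hrows (g : Fin (n - r) → Fin n) : M.submatrix g id * N = 0 := by
    ext i j
    exact congrFun (congrFun hker (g i)) j
  have h₁ := det_submatrix_mul_det_submatrix_of_mul_eq_zero
    (M.submatrix (e ∘ Sum.inr) id) N (hrows _) e f
  have h₂ := det_submatrix_mul_det_submatrix_of_mul_eq_zero
    (M.submatrix (f ∘ Sum.inr) id) N (hrows _) e f
  have hsq : (Equiv.Perm.sign (f.trans e.symm) : K) ^ 2 = 1 := by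
    rcases Int.units_eq_one_or (Equiv.Perm.sign (f.trans e.symm)) with h | h <;> simp [h]
  have htr : (M.submatrix (f ∘ Sum.inr) (e ∘ Sum.inr)).det =
      (M.submatrix (e ∘ Sum.inr) (f ∘ Sum.inr)).det := by
    rw [← det_transpose, transpose_submatrix, hsymm]
  have hMS : deleteRowsCols M S hS' = M.submatrix (e ∘ Sum.inr) (e ∘ Sum.inr) := by
    ext i j
    simp [deleteRowsCols, e]
  have hMT : deleteRowsCols M T hT' = M.submatrix (f ∘ Sum.inr) (f ∘ Sum.inr) := by
    ext i j
    simp [deleteRowsCols, f]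
  have hNS : selectRows N S hS = N.submatrix (e ∘ Sum.inl) id := by
    ext i j
    simp [selectRows, e]
  have hNT : selectRows N T hT = N.submatrix (f ∘ Sum.inl) id := by
    ext i j
    simp [selectRows, f]
  simp only [submatrix_submatrix, Function.id_comp, Function.comp_id, htr] at h₁ h₂
  rw [hMS, hMT, hNS, hNT]
  linear_combination (N.submatrix (f ∘ Sum.inl) id).det * h₁ +
    (Equiv.Perm.sign (f.trans e.symm) : K) * (N.submatrix (e ∘ Sum.inl) id).det * h₂ +
    (M.submatrix (f ∘ Sum.inr) (f ∘ Sum.inr)).det *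
      (N.submatrix (e ∘ Sum.inl) id).det ^ 2 * hsq
end

section
/- Let n ≥ 2 and let κ, κ̃ : {1,…,n} → ℂ² satisfy momentum conservation: ∑_{a=1}^n κ_a(α)·κ̃_a(α̇) = 0 for every α, α̇ ∈ {0,1}. For spinors u, v ∈ ℂ² write ⟨u v⟩ := u₀v₁ − u₁v₀, and abbreviate ⟨a b⟩ := ⟨κ_a κ_b⟩ and [a b] := ⟨κ̃_a κ̃_b⟩. Fix an index i with ⟨i a⟩ ≠ 0 for all a ≠ i, and define D_i(x,y) := ∑_{a ≠ i} ([i a]/⟨i a⟩)·⟨κ_a x⟩·⟨κ_a y⟩ for x, y ∈ ℂ². Then for all x, y, u, v ∈ ℂ²: D_i(x,y)·⟨κ_i u⟩·⟨κ_i v⟩ = D_i(u,v)·⟨κ_i x⟩·⟨κ_i y⟩. -/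
/-- The antisymmetric spinor bracket `⟨u v⟩ = u₀ v₁ - u₁ v₀` on `ℂ²`. -/
def sbracket (u v : Fin 2 → ℂ) : ℂ := u 0 * v 1 - u 1 * v 0

/-- Momentum conservation contracted with arbitrary reference spinors. -/
theorem sum_sbracket_mul_sbracket_eq_zero {ι : Type*} [Fintype ι] (κ κt : ι → Fin 2 → ℂ)
    (hmom : ∀ α β : Fin 2, ∑ a, κ a α * κt a β = 0) (w z : Fin 2 → ℂ) :
    ∑ a, sbracket w (κt a) * sbracket (κ a) z = 0 := by
  calc ∑ a, sbracket w (κt a) * sbracket (κ a) z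
      = ∑ a, (w 0 * z 1 * (κ a 0 * κt a 1) - w 0 * z 0 * (κ a 1 * κt a 1)
          - w 1 * z 1 * (κ a 0 * κt a 0) + w 1 * z 0 * (κ a 1 * κt a 0)) :=
        Finset.sum_congr rfl fun a _ => by simp only [sbracket]; ring
    _ = 0 := by
        simp only [Finset.sum_add_distrib, Finset.sum_sub_distrib, ← Finset.mul_sum, hmom]
        ring

/-- Two applications of the Schouten identity. -/
theorem sbracket_exchange (p q x y u v : Fin 2 → ℂ) :
    sbracket q x * sbracket q y * (sbracket p u * sbracket p v) -
        sbracket q u * sbracket q v * (sbracket p x * sbracket p y) =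
      -sbracket p q * (sbracket x u * sbracket p v * sbracket q y +
        sbracket y v * sbracket p x * sbracket q u) := by
  simp only [sbracket]
  ring

/-- Under momentum conservation, the bilinear form
`D_i(x,y) = ∑_{a ≠ i} ([i a]/⟨i a⟩) ⟨κ_a x⟩ ⟨κ_a y⟩` satisfies
`D_i(x,y) ⟨κ_i u⟩ ⟨κ_i v⟩ = D_i(u,v) ⟨κ_i x⟩ ⟨κ_i y⟩` for all `x, y, u, v ∈ ℂ²`. -/
theorem hodges_diagonal_reference_independence (n : ℕ) (hn : 2 ≤ n)
    (κ κt : Fin n → Fin 2 → ℂ)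
    (hmom : ∀ α β : Fin 2, ∑ a, κ a α * κt a β = 0)
    (i : Fin n) (hne : ∀ a, a ≠ i → sbracket (κ i) (κ a) ≠ 0)
    (D : (Fin 2 → ℂ) → (Fin 2 → ℂ) → ℂ)
    (hD : ∀ x y, D x y = ∑ a ∈ Finset.univ.erase i,
      (sbracket (κt i) (κt a) / sbracket (κ i) (κ a)) *
        sbracket (κ a) x * sbracket (κ a) y)
    (x y u v : Fin 2 → ℂ) :
    D x y * sbracket (κ i) u * sbracket (κ i) v =
      D u v * sbracket (κ i) x * sbracket (κ i) y := by
  have hsum (z : Fin 2 → ℂ) :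
      ∑ a ∈ Finset.univ.erase i, sbracket (κt i) (κt a) * sbracket (κ a) z = 0 := by
    rw [Finset.sum_erase _ (by simp [sbracket, mul_comm])]
    exact sum_sbracket_mul_sbracket_eq_zero κ κt hmom (κt i) z
  rw [← sub_eq_zero, hD, hD]
  simp only [Finset.sum_mul, ← Finset.sum_sub_distrib]
  calc _ = ∑ a ∈ Finset.univ.erase i,
        (-(sbracket x u * sbracket (κ i) v) * (sbracket (κt i) (κt a) * sbracket (κ a) y) -
          sbracket y v * sbracket (κ i) x * (sbracket (κt i) (κt a) * sbracket (κ a) u)) := by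
        refine Finset.sum_congr rfl fun a ha => ?_
        have hcancel := div_mul_cancel₀ (sbracket (κt i) (κt a))
          (hne a (Finset.ne_of_mem_erase ha))
        linear_combination
          sbracket (κt i) (κt a) / sbracket (κ i) (κ a) *
              sbracket_exchange (κ i) (κ a) x y u v -
            (sbracket x u * sbracket (κ i) v * sbracket (κ a) y +
              sbracket y v * sbracket (κ i) x * sbracket (κ a) u) * hcancel
    _ = 0 := by
        rw [Finset.sum_sub_distrib, ← Finset.mul_sum, ← Finset.mul_sum, hsum, hsum]
        ring
end

section
/- Let n ≥ 4 and let κ, κ̃ : {1,…,n} → ℂ² satisfy ⟨a b⟩ ≠ 0 for all a ≠ b and momentum conservation: ∑_{a=1}^n κ_a(α)·κ̃_a(α̇) = 0 for every α, α̇ ∈ {0,1}. Let ℍ be the Hodges matrix indexed by {3,…,n}, with entries ℍ_ab = [a b]/⟨a b⟩ for a ≠ b and ℍ_aa = −∑_{c ∈ {3,…,n}, c ≠ a} ([a c]·⟨c 1⟩·⟨c 2⟩)/(⟨a c⟩·⟨a 1⟩·⟨a 2⟩). Then for all j, j′ ∈ {3,…,n}: det(ℍ with row j and column j deleted) · ⟨1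 j′⟩²·⟨2 j′⟩² = det(ℍ with row j′ and column j′ deleted) · ⟨1 j⟩²·⟨2 j⟩². -/
/-- The Hodges matrix for `n = m + 4` particles.  The two negative-helicity particles
`1, 2` are indexed by `Sum.inl 0, Sum.inl 1`; the positive-helicity particles
`3, …, n` are indexed by `Sum.inr a` for `a : Fin (m+2)`.  Its entries are
`ℍ_ab = [a b]/⟨a b⟩` for `a ≠ b` and
`ℍ_aa = -∑_{c ≠ a} ([a c] ⟨c 1⟩ ⟨c 2⟩)/(⟨a c⟩ ⟨a 1⟩ ⟨a 2⟩)`. -/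
noncomputable def hodgesMatrix (m : ℕ) (κ κt : (Fin 2 ⊕ Fin (m + 2)) → Fin 2 → ℂ) :
    Matrix (Fin (m + 2)) (Fin (m + 2)) ℂ :=
  fun a b =>
    if a = b then
      -∑ c ∈ Finset.univ.erase a,
        sbracket (κt (.inr a)) (κt (.inr c)) * sbracket (κ (.inr c)) (κ (.inl 0)) *
            sbracket (κ (.inr c)) (κ (.inl 1)) /
          (sbracket (κ (.inr a)) (κ (.inr c)) * sbracket (κ (.inr a)) (κ (.inl 0)) *
            sbracket (κ (.inr a)) (κ (.inl 1)))
    else sbracket (κt (.inr a)) (κt (.inr b)) / sbracket (κ (.inr a)) (κ (.inr b))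

/-- The principal minors obtained by deleting one index from a square matrix whose rows and
columns all sum to zero are equal. -/
theorem det_principal_submatrix_eq_of_sum_eq_zero {R : Type*} [CommRing R] {n : ℕ}
    (M : Matrix (Fin (n + 1)) (Fin (n + 1)) R) (hrow : ∀ a, ∑ b, M a b = 0)
    (hcol : ∀ b, ∑ a, M a b = 0) (i j : Fin (n + 1)) :
    (M.submatrix i.succAbove i.succAbove).det = (M.submatrix j.succAbove j.succAbove).det := by
  have h₁ := Matrix.submatrix_succAbove_det_eq_negOnePow_submatrix_succAbove_det
    (M.submatrix id i.succAbove) (funext fun b => (Finset.sum_apply b _ _).trans (hcol _)) i j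
  have h₂ := Matrix.submatrix_succAbove_det_eq_negOnePow_submatrix_succAbove_det'
    (M.submatrix j.succAbove id) (fun a => by simpa using hrow _) i j
  simp only [Matrix.submatrix_submatrix, Function.comp_id, Function.id_comp] at h₁ h₂
  rw [h₁, h₂, smul_smul, Int.units_mul_self, one_smul]

/-- The principal minors of a symmetric matrix annihilating a vector `v` with nonzero entries
are proportional to the squares of the entries of `v`. -/
theorem det_principal_submatrix_mul_sq_eq {K : Type*} [Field K] {n : ℕ}
    (H : Matrix (Fin (n + 1)) (Fin (n + 1)) K) (hH : H.IsSymm) (v : Fin (n + 1) → K)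
    (hv : ∀ a, v a ≠ 0) (hker : ∀ a, ∑ b, H a b * v b = 0) (i j : Fin (n + 1)) :
    (H.submatrix i.succAbove i.succAbove).det * v j ^ 2 =
      (H.submatrix j.succAbove j.succAbove).det * v i ^ 2 := by
  let M : Matrix (Fin (n + 1)) (Fin (n + 1)) K := Matrix.of fun a b => v a * (v b * H a b)
  have hrow : ∀ a, ∑ b, M a b = 0 := fun a => by
    simp only [M, Matrix.of_apply, ← Finset.mul_sum]
    simp [mul_comm (v _) (H _ _), hker]
  have hcol : ∀ b, ∑ a, M a b = 0 := fun b => by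
    rw [← hrow b]
    refine Finset.sum_congr rfl fun a _ => ?_
    simp only [M, Matrix.of_apply, hH.apply b a]
    ring
  have hdet : ∀ k : Fin (n + 1), (M.submatrix k.succAbove k.succAbove).det * v k ^ 2 =
      (∏ a, v a) ^ 2 * (H.submatrix k.succAbove k.succAbove).det := fun k => by
    have h : M.submatrix k.succAbove k.succAbove = Matrix.of fun a b => v (k.succAbove a) *
        (Matrix.of fun a b => v (k.succAbove b) * H.submatrix k.succAbove k.succAbove a b) a b :=
      rfl
    rw [h, Matrix.det_mul_column, Matrix.det_mul_row, Fin.prod_univ_succAbove v k]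
    ring
  have hP : (∏ a, v a) ^ 2 ≠ 0 := pow_ne_zero 2 (Finset.prod_ne_zero_iff.2 fun a _ => hv a)
  apply mul_left_cancel₀ hP
  rw [← mul_assoc, ← mul_assoc, ← hdet i, ← hdet j,
    det_principal_submatrix_eq_of_sum_eq_zero M hrow hcol i j]
  ring

theorem sbracket_swap (u v : Fin 2 → ℂ) : sbracket u v = -sbracket v u := by
  unfold sbracket
  ring

theorem hodgesMatrix_isSymm (m : ℕ) (κ κt : (Fin 2 ⊕ Fin (m + 2)) → Fin 2 → ℂ) :
    (hodgesMatrix m κ κt).IsSymm := by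
  refine Matrix.IsSymm.ext fun a b => ?_
  rcases eq_or_ne a b with rfl | hab
  · rfl
  · simp only [hodgesMatrix, if_neg hab, if_neg hab.symm]
    rw [sbracket_swap (κt (.inr b)), sbracket_swap (κ (.inr b)), neg_div_neg_eq]

/-- The vector `⟨a 1⟩⟨a 2⟩` lies in the kernel of the Hodges matrix. -/
theorem sum_hodgesMatrix_mul_eq_zero (m : ℕ) (κ κt : (Fin 2 ⊕ Fin (m + 2)) → Fin 2 → ℂ)
    (hne : ∀ a b : Fin 2 ⊕ Fin (m + 2), a ≠ b → sbracket (κ a) (κ b) ≠ 0) (a : Fin (m + 2)) :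
    ∑ b, hodgesMatrix m κ κt a b *
      (sbracket (κ (.inl 0)) (κ (.inr b)) * sbracket (κ (.inl 1)) (κ (.inr b))) = 0 := by
  rw [← Finset.add_sum_erase _ _ (Finset.mem_univ a), hodgesMatrix, if_pos rfl, neg_mul,
    Finset.sum_mul, neg_add_eq_zero]
  refine Finset.sum_congr rfl fun b hb => ?_
  have hab : a ≠ b := (Finset.ne_of_mem_erase hb).symm
  have h₀ := hne (.inl 0) (.inr a) (by simp)
  have h₁ := hne (.inl 1) (.inr a) (by simp)
  have h₂ := hne (.inr a) (.inr b) (by simpa using hab)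
  rw [hodgesMatrix, if_neg hab, sbracket_swap (κ (.inr a)) (κ (.inl 0)),
    sbracket_swap (κ (.inr a)) (κ (.inl 1)), sbracket_swap (κ (.inr b)) (κ (.inl 0)),
    sbracket_swap (κ (.inr b)) (κ (.inl 1))]
  field_simp

/-- Under momentum conservation (and nonvanishing of all angle brackets), the reduced
determinant of the Hodges matrix is independent of the choice of deleted row/column `j`:
`det(ℍ^j_j) ⟨1 j'⟩² ⟨2 j'⟩² = det(ℍ^{j'}_{j'}) ⟨1 j⟩² ⟨2 j⟩²`. -/
theorem hodges_reduced_det_independent (m : ℕ)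
    (κ κt : (Fin 2 ⊕ Fin (m + 2)) → Fin 2 → ℂ)
    (hne : ∀ a b : Fin 2 ⊕ Fin (m + 2), a ≠ b → sbracket (κ a) (κ b) ≠ 0)
    (hmom : ∀ α β : Fin 2, ∑ a, κ a α * κt a β = 0)
    (j j' : Fin (m + 2)) :
    ((hodgesMatrix m κ κt).submatrix j.succAbove j.succAbove).det *
        sbracket (κ (.inl 0)) (κ (.inr j')) ^ 2 *
        sbracket (κ (.inl 1)) (κ (.inr j')) ^ 2 =
      ((hodgesMatrix m κ κt).submatrix j'.succAbove j'.succAbove).det *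
        sbracket (κ (.inl 0)) (κ (.inr j)) ^ 2 *
        sbracket (κ (.inl 1)) (κ (.inr j)) ^ 2 := by
  have h := det_principal_submatrix_mul_sq_eq _ (hodgesMatrix_isSymm m κ κt)
    (fun b => sbracket (κ (.inl 0)) (κ (.inr b)) * sbracket (κ (.inl 1)) (κ (.inr b)))
    (fun b => mul_ne_zero (hne _ _ (by simp)) (hne _ _ (by simp)))
    (sum_hodgesMatrix_mul_eq_zero m κ κt hne) j j'
  simpa only [mul_pow, ← mul_assoc] using h
end

section
/- Let d be a natural number and let f : ℂ² → ℂ be holomorphic on ℂ² ∖ {0} (complex differentiable at every nonzero point) and homogeneous of degree d: f(t·z) = t^d · f(z) for every t ∈ ℂ ∖ {0} and every z ∈ ℂ² ∖ {0}. Then f is a homogeneous polynomial of degree d: there exist coefficients c₀, …, c_d ∈ ℂ such that f(z₁, z₂) = ∑_{k=0}^{d} c_k · z₁^k · z₂^{d−k} for all (z₁, z₂) ≠ (0,0). -/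
open Filter Topology in
/-- Cauchy estimates: an entire function of growth `O(‖w‖ ^ d)` has vanishing derivatives of
order `n > d` at the origin. -/
theorem iteratedDeriv_eq_zero_of_norm_le_mul_pow {g : ℂ → ℂ} (hg : Differentiable ℂ g) {C : ℝ}
    {d n : ℕ} (hC : ∀ w : ℂ, 1 ≤ ‖w‖ → ‖g w‖ ≤ C * ‖w‖ ^ d) (hn : d < n) :
    iteratedDeriv n g 0 = 0 := by
  obtain ⟨m, rfl⟩ := Nat.exists_eq_add_of_lt hn
  have hlim : Tendsto (fun R : ℝ => (d + m + 1).factorial * C / R ^ (m + 1)) atTop (𝓝 0) :=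
    tendsto_const_nhds.div_atTop (tendsto_pow_atTop m.succ_ne_zero)
  rw [← norm_le_zero_iff]
  refine ge_of_tendsto hlim ?_
  filter_upwards [eventually_ge_atTop 1] with R hR
  have hR0 : 0 < R := by linarith
  refine (Complex.norm_iteratedDeriv_le_of_forall_mem_sphere_norm_le (d + m + 1) hR0
    hg.diffContOnCl (C := C * R ^ d) fun w hw => ?_).trans (le_of_eq ?_)
  · rw [mem_sphere_zero_iff_norm] at hw
    simpa [hw] using hC w (hw.symm ▸ hR)
  · rw [add_assoc d m 1, pow_add]
    field_simp

/-- An entire function of growth `O(‖w‖ ^ d)` is a polynomial of degree at most `d`. -/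
theorem exists_eq_sum_pow_of_norm_le_mul_pow {g : ℂ → ℂ} (hg : Differentiable ℂ g) {C : ℝ} {d : ℕ}
    (hC : ∀ w : ℂ, 1 ≤ ‖w‖ → ‖g w‖ ≤ C * ‖w‖ ^ d) :
    ∃ c : Fin (d + 1) → ℂ, ∀ w : ℂ, g w = ∑ k : Fin (d + 1), c k * w ^ (k : ℕ) := by
  refine ⟨fun k => (k.1.factorial : ℂ)⁻¹ * iteratedDeriv k g 0, fun w => ?_⟩
  rw [← Complex.taylorSeries_eq_of_entire' 0 w hg, tsum_eq_sum (s := Finset.range (d + 1)),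
    Finset.sum_range]
  · simp
  · intro n hn
    rw [iteratedDeriv_eq_zero_of_norm_le_mul_pow hg hC (by simpa using hn)]
    simp

/-- **Liouville theorem for `O(d)`.** A function holomorphic on `ℂ² \ {0}` and
homogeneous of degree `d ≥ 0` is a homogeneous polynomial of degree `d`. -/
theorem homogeneous_holomorphic_is_polynomial (d : ℕ) (f : ℂ × ℂ → ℂ)
    (hf : ∀ z : ℂ × ℂ, z ≠ 0 → DifferentiableAt ℂ f z)
    (hhom : ∀ t : ℂ, t ≠ 0 → ∀ z : ℂ × ℂ, z ≠ 0 → f (t • z) = t ^ d * f z) :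
    ∃ c : Fin (d + 1) → ℂ, ∀ z : ℂ × ℂ, z ≠ 0 →
      f z = ∑ k : Fin (d + 1), c k * z.1 ^ (k : ℕ) * z.2 ^ (d - (k : ℕ)) := by
  have hg : Differentiable ℂ fun w : ℂ => f (w, 1) := fun w =>
    (hf (w, 1) (by simp)).comp w (by fun_prop : DifferentiableAt ℂ (fun w : ℂ => (w, (1 : ℂ))) w)
  have hh : Continuous fun v : ℂ => f (1, v) := continuous_iff_continuousAt.2 fun v =>
    (hf (1, v) (by simp)).continuousAt.comp (f := fun v : ℂ => ((1 : ℂ), v)) (by fun_prop)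
  obtain ⟨C, hC⟩ := (isCompact_closedBall (0 : ℂ) 1).exists_bound_of_continuousOn hh.continuousOn
  have hgrowth : ∀ w : ℂ, 1 ≤ ‖w‖ → ‖f (w, 1)‖ ≤ C * ‖w‖ ^ d := by
    intro w hw
    have hw0 : w ≠ 0 := norm_pos_iff.1 (by linarith)
    have h := hhom w hw0 (1, w⁻¹) (by simp)
    simp only [Prod.smul_mk, smul_eq_mul, mul_one, mul_inv_cancel₀ hw0] at h
    rw [h, norm_mul, norm_pow, mul_comm]
    gcongr
    exact hC _ (by simpa using inv_le_one_of_one_le₀ hw)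
  obtain ⟨c, hc⟩ := exists_eq_sum_pow_of_norm_le_mul_pow hg hgrowth
  have hne : ∀ x y : ℂ, y ≠ 0 →
      f (x, y) = ∑ k : Fin (d + 1), c k * x ^ (k : ℕ) * y ^ (d - (k : ℕ)) := by
    intro x y hy
    have h := hhom y hy (x / y, 1) (by simp)
    simp only [Prod.smul_mk, smul_eq_mul, mul_one, mul_div_cancel₀ x hy] at h
    rw [h, hc, Finset.mul_sum]
    refine Finset.sum_congr rfl fun k _ => ?_
    rw [← pow_mul_pow_sub y (Nat.lt_succ_iff.1 k.2), div_pow]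
    field_simp
  refine ⟨c, fun ⟨x, y⟩ hz => ?_⟩
  rcases ne_or_eq y 0 with hy | rfl
  · exact hne x y hy
  have hcont : ContinuousAt (fun t : ℂ => f (x, t)) 0 :=
    (hf (x, 0) hz).continuousAt.comp (f := fun t : ℂ => (x, t)) (by fun_prop)
  have hpoly : ContinuousAt (fun t : ℂ =>
      ∑ k : Fin (d + 1), c k * x ^ (k : ℕ) * t ^ (d - (k : ℕ))) 0 := by fun_prop
  refine tendsto_nhds_unique (hcont.tendsto.mono_left (nhdsWithin_le_nhds (s := {0}ᶜ)))
    ((hpoly.tendsto.mono_left nhdsWithin_le_nhds).congr' ?_)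
  filter_upwards [self_mem_nhdsWithin] with t ht
  exact (hne x t ht).symm
end

section
/- Let U ⊆ ℂ⁴ be open with complex coordinates (z¹, z², z̃¹, z̃²) and let Ω : U → ℂ be holomorphic. Write Ω_{αβ̃} := ∂²Ω/∂z^α ∂z̃^β̃, and suppose Ω satisfies Plebanski's first heavenly equation on U: Ω_{11̃}·Ω_{22̃} − Ω_{12̃}·Ω_{21̃} = 1. For (λ₁, λ₂) ∈ ℂ² define the first-order differential operators acting on holomorphic functions f : U → ℂ by L₁f := λ₂·∂f/∂z¹ + λ₁·(Ω_{12̃}·∂f/∂z̃¹ − Ω_{11̃}·∂f/∂z̃²) and L₂f := λ₂·∂f/∂z² + λ₁·(Ω_{22̃}·∂f/∂z̃¹ − Ω_{21̃}·∂f/∂z̃²). Then the Lax pair commutes: for every holomorphic f : U → ℂ and every (λ₁, λ₂) ∈ ℂ², L₁(L₂f) = L₂(L₁f) on U. -/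
/-- The holomorphic partial derivative of `f : ℂ⁴ → ℂ` in the `i`-th coordinate
direction. -/
noncomputable def pd (i : Fin 4) (f : (Fin 4 → ℂ) → ℂ) (x : Fin 4 → ℂ) : ℂ :=
  fderiv ℂ f x (Pi.single i 1)

/-- The first Lax operator
`L₁ f = λ₂ ∂f/∂z¹ + λ₁ (Ω_{12̃} ∂f/∂z̃¹ − Ω_{11̃} ∂f/∂z̃²)` associated with the first
Plebanski scalar `Ω`.  Coordinates on `ℂ⁴`: `z¹, z², z̃¹, z̃²` are indexed by
`0, 1, 2, 3`, and `Ω_{αβ̃} = ∂²Ω/∂z^α ∂z̃^β̃`. -/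
noncomputable def Lax1 (Ω : (Fin 4 → ℂ) → ℂ) (l1 l2 : ℂ) (f : (Fin 4 → ℂ) → ℂ) :
    (Fin 4 → ℂ) → ℂ :=
  fun x => l2 * pd 0 f x +
    l1 * (pd 3 (pd 0 Ω) x * pd 2 f x - pd 2 (pd 0 Ω) x * pd 3 f x)

/-- The second Lax operator
`L₂ f = λ₂ ∂f/∂z² + λ₁ (Ω_{22̃} ∂f/∂z̃¹ − Ω_{21̃} ∂f/∂z̃²)`. -/
noncomputable def Lax2 (Ω : (Fin 4 → ℂ) → ℂ) (l1 l2 : ℂ) (f : (Fin 4 → ℂ) → ℂ) :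
    (Fin 4 → ℂ) → ℂ :=
  fun x => l2 * pd 1 f x +
    l1 * (pd 3 (pd 1 Ω) x * pd 2 f x - pd 2 (pd 1 Ω) x * pd 3 f x)

open Set Filter Topology Metric

section Regularity

variable {E : Type*} [NormedAddCommGroup E] [NormedSpace ℂ E]

/-- A function that is complex differentiable near `x` has bounded derivative near `x`. -/
lemma exists_fderiv_norm_le_of_differentiableOn {f : E → ℂ} {U : Set E} (hU : IsOpen U)
    (hf : DifferentiableOn ℂ f U) {x : E} (hx : x ∈ U) :
    ∃ R > 0, ball x R ⊆ U ∧ ∃ C, ∀ y ∈ ball x R, ‖fderiv ℂ f y‖ ≤ C := by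
  have hc : ∀ᶠ y in 𝓝 x, y ∈ U ∧ dist (f y) (f x) < 1 :=
    (hU.eventually_mem hx).and
      ((hf.differentiableAt (hU.mem_nhds hx)).continuousAt.eventually (ball_mem_nhds _ one_pos))
  obtain ⟨R, hR, hball⟩ := Metric.eventually_nhds_iff_ball.1 hc
  refine ⟨R / 2, by positivity, fun y hy => (hball y (ball_subset_ball (by linarith) hy)).1,
    2 / (R / 2), fun y hy => ?_⟩
  have hsub : ball y (R / 2) ⊆ ball x R :=
    ball_subset_ball' (by rw [mem_ball] at hy; linarith)
  refine Complex.norm_fderiv_le_div_of_mapsTo_ball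
    (hf.mono fun z hz => (hball z (hsub hz)).1) (fun z hz => ?_) (by positivity)
  have h1 := (hball z (hsub hz)).2
  have h2 := (hball y (hsub (mem_ball_self (by positivity)))).2
  rw [mem_closedBall]
  linarith [dist_triangle_right (f z) (f y) (f x)]

/-- Cauchy's integral formula for directional derivatives. -/
lemma fderiv_apply_eq_circleIntegral {f : E → ℂ} {y v : E} {r : ℝ} (hr : 0 < r)
    (hf : ∀ t ∈ closedBall (0 : ℂ) r, DifferentiableAt ℂ f (y + t • v)) :
    fderiv ℂ f y v =
      (2 * Real.pi * Complex.I)⁻¹ * ∮ t in C(0, r), (1 / (t - 0) ^ 2) • f (y + t • v) := by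
  have hline (t : ℂ) : HasDerivAt (fun t : ℂ => y + t • v) v t := by
    simpa using ((hasDerivAt_id t).smul_const v).const_add y
  have hd (t : ℂ) (ht : t ∈ closedBall (0 : ℂ) r) :
      HasDerivAt (fun t : ℂ => f (y + t • v)) (fderiv ℂ f (y + t • v) v) t :=
    (hf t ht).hasFDerivAt.comp_hasDerivAt t (hline t)
  rw [DifferentiableOn.deriv_eq_smul_circleIntegral hr
    fun t ht => (hd t ht).differentiableAt.differentiableWithinAt,
    (hd 0 (mem_closedBall_self hr.le)).deriv, smul_eq_mul, inv_mul_cancel_left₀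
    Complex.two_pi_I_ne_zero, zero_smul, add_zero]

/-- Directional derivatives of a holomorphic function of several variables are holomorphic. -/
lemma DifferentiableOn.fderiv_apply_const [FiniteDimensional ℂ E] {f : E → ℂ} {U : Set E}
    (hU : IsOpen U) (hf : DifferentiableOn ℂ f U) (v : E) :
    DifferentiableOn ℂ (fun y => fderiv ℂ f y v) U := by
  intro x hx
  apply DifferentiableAt.differentiableWithinAt
  obtain ⟨R, hR, hRU, C, hC⟩ := exists_fderiv_norm_le_of_differentiableOn hU hf hx
  have hfR (y : E) (hy : y ∈ ball x R) : DifferentiableAt ℂ f y :=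
    hf.differentiableAt (hU.mem_nhds (hRU hy))
  obtain ⟨r, hr, hrv⟩ : ∃ r > 0, r * ‖v‖ < R / 2 := by
    refine ⟨R / 2 / (‖v‖ + 1), by positivity, ?_⟩
    rw [div_mul_eq_mul_div, div_lt_iff₀ (by positivity)]
    nlinarith [norm_nonneg v]
  have hmem (y : E) (hy : y ∈ ball x (R / 2)) (t : ℂ) (ht : t ∈ closedBall (0 : ℂ) r) :
      y + t • v ∈ ball x R := by
    rw [mem_ball, dist_eq_norm] at hy ⊢
    rw [mem_closedBall, dist_zero_right] at ht
    calc ‖y + t • v - x‖ = ‖(y - x) + t • v‖ := by congr 1; abel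
      _ ≤ ‖y - x‖ + ‖t‖ * ‖v‖ := (norm_add_le _ _).trans_eq (by rw [norm_smul])
      _ ≤ ‖y - x‖ + r * ‖v‖ := by gcongr
      _ < R := by linarith
  have hcirc (θ : ℝ) : circleMap 0 r θ ∈ closedBall (0 : ℂ) r :=
    circleMap_mem_closedBall 0 hr.le θ
  let k : ℝ → ℂ := fun θ => _root_.deriv (circleMap 0 r) θ * (1 / (circleMap 0 r θ - 0) ^ 2)
  have hk : Continuous k := by
    have hne (θ : ℝ) : (circleMap 0 r θ - 0) ^ 2 ≠ 0 := by
      rw [sub_zero]; exact pow_ne_zero 2 (circleMap_ne_center hr.ne')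
    have : Continuous (circleMap 0 r) := continuous_circleMap 0 r
    simp only [k, deriv_circleMap]
    fun_prop (disch := exact hne _)
  have hF (y : E) (hy : y ∈ ball x (R / 2)) :
      Continuous fun θ => k θ * f (y + circleMap 0 r θ • v) := by
    refine hk.mul (continuous_iff_continuousAt.2 fun θ => ?_)
    have hline : Continuous fun θ => y + circleMap 0 r θ • v :=
      continuous_const.add ((continuous_circleMap 0 r).smul continuous_const)
    exact ContinuousAt.comp (g := f) (hfR _ (hmem y hy _ (hcirc θ))).continuousAt
      hline.continuousAt
  have hnhds : ball x (R / 2) ∈ 𝓝 x := ball_mem_nhds x (by positivity)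
  have hint : HasFDerivAt
      (fun y => ∫ θ in (0 : ℝ)..2 * Real.pi, k θ * f (y + circleMap 0 r θ • v))
      (∫ θ in (0 : ℝ)..2 * Real.pi, k θ • fderiv ℂ f (x + circleMap 0 r θ • v)) x := by
    refine intervalIntegral.hasFDerivAt_integral_of_dominated_of_fderiv_le
      (F' := fun y θ => k θ • fderiv ℂ f (y + circleMap 0 r θ • v))
      (bound := fun θ => ‖k θ‖ * C) hnhds ?_ ?_ ?_ ?_ ?_ ?_
    · filter_upwards [hnhds] with y hy using (hF y hy).aestronglyMeasurable
    · exact (hF x (mem_of_mem_nhds hnhds)).intervalIntegrable _ _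
    · borelize E
      have : ProperSpace E := FiniteDimensional.proper ℂ E
      have hline : Continuous fun θ => x + circleMap 0 r θ • v :=
        continuous_const.add ((continuous_circleMap 0 r).smul continuous_const)
      exact hk.aestronglyMeasurable.smul
        ((measurable_fderiv ℂ f).comp hline.measurable).aestronglyMeasurable
    · refine MeasureTheory.ae_of_all _ fun θ _ y hy => ?_
      rw [norm_smul]
      exact mul_le_mul_of_nonneg_left (hC _ (hmem y hy _ (hcirc θ))) (norm_nonneg _)
    · exact (hk.norm.mul continuous_const).intervalIntegrable _ _
    · refine MeasureTheory.ae_of_all _ fun θ _ y hy => ?_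
      have h := (hfR _ (hmem y hy _ (hcirc θ))).hasFDerivAt.comp y
        ((hasFDerivAt_id y).add_const (circleMap 0 r θ • v))
      exact h.const_mul (k θ)
  refine (hint.differentiableAt.const_mul (2 * Real.pi * Complex.I)⁻¹).congr_of_eventuallyEq ?_
  filter_upwards [hnhds] with y hy
  rw [fderiv_apply_eq_circleIntegral hr fun t ht => hfR _ (hmem y hy t ht), circleIntegral]
  simp only [smul_eq_mul, k, mul_assoc]

end Regularity

section PartialDerivatives

variable {U : Set (Fin 4 → ℂ)} {f g : (Fin 4 → ℂ) → ℂ} {x : Fin 4 → ℂ}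

lemma DifferentiableOn.pd (hU : IsOpen U) (hf : DifferentiableOn ℂ f U) (i : Fin 4) :
    DifferentiableOn ℂ (pd i f) U :=
  hf.fderiv_apply_const hU _

lemma pd_congr (hU : IsOpen U) (h : EqOn f g U) (hx : x ∈ U) (i : Fin 4) :
    pd i f x = pd i g x := by
  rw [pd, pd, (h.eventuallyEq_of_mem (hU.mem_nhds hx)).fderiv_eq]

lemma pd_comm (hU : IsOpen U) (hf : DifferentiableOn ℂ f U) (hx : x ∈ U) (i j : Fin 4) :
    pd i (pd j f) x = pd j (pd i f) x := by
  have hfd : DifferentiableAt ℂ (fderiv ℂ f) x := by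
    have hsum : fderiv ℂ f = fun y => ∑ k : Fin 4,
        pd k f y • ContinuousLinearMap.proj (R := ℂ) (φ := fun _ : Fin 4 => ℂ) k := by
      ext y v
      conv_lhs => rw [← Finset.univ_sum_single v]
      simp only [map_sum, sum_apply, smul_apply,
        ContinuousLinearMap.proj_apply, smul_eq_mul]
      refine Finset.sum_congr rfl fun k _ => ?_
      rw [show (Pi.single k (v k) : Fin 4 → ℂ) = v k • Pi.single k 1 by
        rw [← Pi.single_smul, smul_eq_mul, mul_one], map_smul, smul_eq_mul, mul_comm, pd]
    rw [hsum]
    exact DifferentiableAt.fun_sum fun k _ =>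
      ((hf.pd hU k).differentiableAt (hU.mem_nhds hx)).smul_const _
  have hpd (i j : Fin 4) :
      pd i (pd j f) x = fderiv ℂ (fderiv ℂ f) x (Pi.single i 1) (Pi.single j 1) := by
    have h : HasFDerivAt (pd j f) _ x := hfd.hasFDerivAt.clm_apply
      (hasFDerivAt_const (Pi.single j (1 : ℂ) : Fin 4 → ℂ) x)
    rw [pd, h.fderiv]
    simp
  rw [hpd, hpd]
  refine second_derivative_symmetric_of_eventually (𝕜 := ℂ) (f := f) ?_ hfd.hasFDerivAt _ _
  filter_upwards [hU.mem_nhds hx] with y hy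
  exact (hf.differentiableAt (hU.mem_nhds hy)).hasFDerivAt

lemma pd_add (hf : DifferentiableAt ℂ f x) (hg : DifferentiableAt ℂ g x) (i : Fin 4) :
    pd i (fun y => f y + g y) x = pd i f x + pd i g x := by
  simp only [pd, fderiv_fun_add hf hg, add_apply]

lemma pd_sub (hf : DifferentiableAt ℂ f x) (hg : DifferentiableAt ℂ g x) (i : Fin 4) :
    pd i (fun y => f y - g y) x = pd i f x - pd i g x := by
  simp only [pd, fderiv_fun_sub hf hg, sub_apply]

lemma pd_mul (hf : DifferentiableAt ℂ f x) (hg : DifferentiableAt ℂ g x) (i : Fin 4) :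
    pd i (fun y => f y * g y) x = f x * pd i g x + g x * pd i f x := by
  simp only [pd, fderiv_fun_mul hf hg, add_apply,
    smul_apply, smul_eq_mul]

lemma pd_const (c : ℂ) (i : Fin 4) : pd i (fun _ => c) x = 0 := by
  simp [pd]

lemma pd_const_mul (c : ℂ) (hf : DifferentiableAt ℂ f x) (i : Fin 4) :
    pd i (fun y => c * f y) x = c * pd i f x := by
  rw [pd_mul (differentiableAt_const c) hf, pd_const, mul_zero, add_zero]

end PartialDerivatives

/-- If the holomorphic function `Ω` satisfies Plebanski's first heavenly equation
`Ω_{11̃} Ω_{22̃} − Ω_{12̃} Ω_{21̃} = 1` on the open set `U ⊆ ℂ⁴`, then the Lax pair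
commutes on every holomorphic function `f` for every value of the spectral
parameters `(λ₁, λ₂)`. -/
theorem first_heavenly_lax_pair_commutes (U : Set (Fin 4 → ℂ)) (hU : IsOpen U)
    (Ω : (Fin 4 → ℂ) → ℂ) (hΩ : DifferentiableOn ℂ Ω U)
    (heavenly : ∀ x ∈ U,
      pd 2 (pd 0 Ω) x * pd 3 (pd 1 Ω) x - pd 3 (pd 0 Ω) x * pd 2 (pd 1 Ω) x = 1)
    (f : (Fin 4 → ℂ) → ℂ) (hf : DifferentiableOn ℂ f U) (l1 l2 : ℂ) :
    ∀ x ∈ U, Lax1 Ω l1 l2 (Lax2 Ω l1 l2 f) x = Lax2 Ω l1 l2 (Lax1 Ω l1 l2 f) x := by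
  intro x hx
  have hat {g : (Fin 4 → ℂ) → ℂ} (hg : DifferentiableOn ℂ g U) : DifferentiableAt ℂ g x :=
    hg.differentiableAt (hU.mem_nhds hx)
  have df (i : Fin 4) : DifferentiableAt ℂ (pd i f) x := hat (hf.pd hU i)
  have dΩ (i j : Fin 4) : DifferentiableAt ℂ (pd i (pd j Ω)) x := hat ((hΩ.pd hU j).pd hU i)
  have expand (i a : Fin 4) :
      pd i (fun y => l2 * pd a f y +
        l1 * (pd 3 (pd a Ω) y * pd 2 f y - pd 2 (pd a Ω) y * pd 3 f y)) x =
      l2 * pd i (pd a f) x +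
        l1 * (pd 3 (pd a Ω) x * pd i (pd 2 f) x + pd 2 f x * pd i (pd 3 (pd a Ω)) x -
          (pd 2 (pd a Ω) x * pd i (pd 3 f) x + pd 3 f x * pd i (pd 2 (pd a Ω)) x)) := by
    have h2 := (dΩ 3 a).fun_mul (df 2)
    have h3 := (dΩ 2 a).fun_mul (df 3)
    rw [pd_add ((df a).const_mul l2) ((h2.fun_sub h3).const_mul l1), pd_const_mul l2 (df a),
      pd_const_mul l1 (h2.fun_sub h3), pd_sub h2 h3, pd_mul (dΩ 3 a) (df 2),
      pd_mul (dΩ 2 a) (df 3)]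
  have det_deriv (i : Fin 4) :
      pd 2 (pd 0 Ω) x * pd i (pd 3 (pd 1 Ω)) x + pd 3 (pd 1 Ω) x * pd i (pd 2 (pd 0 Ω)) x -
        (pd 3 (pd 0 Ω) x * pd i (pd 2 (pd 1 Ω)) x +
          pd 2 (pd 1 Ω) x * pd i (pd 3 (pd 0 Ω)) x) = 0 := by
    rw [← pd_mul (dΩ 2 0) (dΩ 3 1), ← pd_mul (dΩ 3 0) (dΩ 2 1),
      ← pd_sub ((dΩ 2 0).fun_mul (dΩ 3 1)) ((dΩ 3 0).fun_mul (dΩ 2 1)),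
      pd_congr hU (g := fun _ => 1) heavenly hx, pd_const]
  have fcomm (i j : Fin 4) : pd i (pd j f) x = pd j (pd i f) x := pd_comm hU hf hx i j
  have Ωcomm (i j a : Fin 4) : pd i (pd j (pd a Ω)) x = pd j (pd i (pd a Ω)) x :=
    pd_comm hU (hΩ.pd hU a) hx i j
  have Ωcomm' (i : Fin 4) : pd 0 (pd i (pd 1 Ω)) x = pd 1 (pd i (pd 0 Ω)) x := by
    rw [Ωcomm 0 i 1, Ωcomm 1 i 0]
    exact pd_congr hU (fun y hy => pd_comm hU hΩ hy 0 1) hx i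
  unfold Lax1 Lax2
  simp only [expand]
  rw [Ωcomm' 2, Ωcomm' 3, Ωcomm 2 3 0, Ωcomm 2 3 1, fcomm 0 1, fcomm 0 2, fcomm 0 3,
    fcomm 1 2, fcomm 1 3, fcomm 2 3]
  have h2 := det_deriv 2
  have h3 := det_deriv 3
  rw [Ωcomm 2 3 0, Ωcomm 2 3 1] at h2
  linear_combination l1 ^ 2 * pd 3 f x * h2 - l1 ^ 2 * pd 2 f x * h3
end
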